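/- arXiv:2108.11336 — 6 statements merged into one kernel-verified Lean document; each statement's English description precedes it below -/
import Mathlib

section
/- For the noise-free linear regression model y_k = φ_{k−1}ᵀθ* with estimates produced by the projection algorithm, the parameter error norm is monotonically nonincreasing: for every k ≥ 1, ‖θ_k − θ*‖ ≤ ‖θ_{k−1} − θ*‖, and in particular ‖θ_k − θ*‖ ≤ ‖θ_0 − θ*‖ for all k. -/
open scoped RealInnerProductSpace

/-- Subtracting a relaxed multiple of the component of `e` along `p` does not increase the norm. -/
theorem norm_sub_smul_inner_smul_le {E : Type*} [NormedAddCommGroup E] [InnerProductSpace ℝ E]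
    {c : ℝ} (p e : E) (hc : 0 ≤ c) (hcp : c * ‖p‖ ^ 2 ≤ 2) :
    ‖e - (c * ⟪p, e⟫) • p‖ ≤ ‖e‖ := by
  refine (sq_le_sq₀ (norm_nonneg _) (norm_nonneg _)).1 ?_
  have key : ‖e - (c * ⟪p, e⟫) • p‖ ^ 2 =
      ‖e‖ ^ 2 - c * ⟪p, e⟫ ^ 2 * (2 - c * ‖p‖ ^ 2) := by
    rw [norm_sub_sq_real, norm_smul, mul_pow, Real.norm_eq_abs, sq_abs, real_inner_smul_right,
      real_inner_comm p e]
    ring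
  have hnonneg : 0 ≤ c * ⟪p, e⟫ ^ 2 * (2 - c * ‖p‖ ^ 2) :=
    mul_nonneg (mul_nonneg hc (sq_nonneg _)) (sub_nonneg.2 hcp)
  linarith

/-- **Projection algorithm, noise-free case: monotone parameter error.**
For the linear regression model `y k = ⟪φ (k-1), θ*⟫` (noise free) and estimates
produced by the projection algorithm
`θ k = θ (k-1) + (γ/(1 + ⟪φ (k-1), φ (k-1)⟫)) • (y k − ⟪φ (k-1), θ (k-1)⟫) • φ (k-1)`
with `0 < γ < 2`, the parameter error norm is monotonically nonincreasing, and in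
particular bounded by the initial error. -/
theorem projection_algorithm_error_nonincreasing
    (N : ℕ) (θstar : EuclideanSpace ℝ (Fin N)) (φ : ℕ → EuclideanSpace ℝ (Fin N))
    (y : ℕ → ℝ) (θ : ℕ → EuclideanSpace ℝ (Fin N)) (γ : ℝ)
    (hγ0 : 0 < γ) (hγ2 : γ < 2)
    (hmodel : ∀ k : ℕ, y (k + 1) = ⟪φ k, θstar⟫)
    (hupdate : ∀ k : ℕ,
      θ (k + 1) = θ k + (γ / (1 + ⟪φ k, φ k⟫)) • ((y (k + 1) - ⟪φ k, θ k⟫) • φ k)) :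
    (∀ k : ℕ, ‖θ (k + 1) - θstar‖ ≤ ‖θ k - θstar‖) ∧
      (∀ k : ℕ, ‖θ k - θstar‖ ≤ ‖θ 0 - θstar‖) := by
  have hstep : ∀ k : ℕ, ‖θ (k + 1) - θstar‖ ≤ ‖θ k - θstar‖ := by
    intro k
    have hpos : 0 < 1 + ‖φ k‖ ^ 2 := by positivity
    have herr : θ (k + 1) - θstar = (θ k - θstar) -
        (γ / (1 + ‖φ k‖ ^ 2) * ⟪φ k, θ k - θstar⟫) • φ k := by
      rw [hupdate, hmodel, real_inner_self_eq_norm_sq, inner_sub_right]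
      module
    rw [herr]
    refine norm_sub_smul_inner_smul_le _ _ (by positivity) ?_
    rw [div_mul_eq_mul_div, div_le_iff₀ hpos]
    nlinarith [sq_nonneg ‖φ k‖]
  exact ⟨hstep, fun k => antitone_nat_of_succ_le (f := fun k => ‖θ k - θstar‖) hstep k.zero_le⟩
end

section
/- For the noise-free linear regression model y_k = φ_{k−1}ᵀθ* with estimates produced by the projection algorithm, the increments of the estimates vanish asymptotically: for every fixed t ∈ ℕ, lim_{k→∞} ‖θ_k − θ_{k−t}‖ = 0. -/
open scoped RealInnerProductSpace
open Filter

/-- The increment `d` of a relaxed, regularized projection step satisfies `‖d‖² ≤ -γ ⟪e, d⟫`,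
where `e` is the current estimation error. -/
lemma norm_sq_projection_step_le {E : Type*} [NormedAddCommGroup E] [InnerProductSpace ℝ E]
    {γ : ℝ} (hγ : 0 ≤ γ) (v e : E) :
    ‖(γ / (1 + ⟪v, v⟫)) • ((-⟪v, e⟫) • v)‖ ^ 2 ≤
      -(γ * ⟪e, (γ / (1 + ⟪v, v⟫)) • ((-⟪v, e⟫) • v)⟫) := by
  have hs : 0 ≤ ⟪v, v⟫ := real_inner_self_nonneg
  set q := γ / (1 + ⟪v, v⟫)
  have hq0 : 0 ≤ q := by positivity
  have hqs : q * (1 + ⟪v, v⟫) = γ := div_mul_cancel₀ _ (by positivity)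
  rw [← real_inner_self_eq_norm_sq]
  simp only [real_inner_smul_left, real_inner_smul_right, real_inner_comm v e]
  have h : 0 ≤ q * ⟪v, e⟫ ^ 2 * (γ - q * ⟪v, v⟫) := by
    have : 0 ≤ γ - q * ⟪v, v⟫ := by linarith
    positivity
  linarith

/-- If every increment `d` of a sequence satisfies `‖d‖² ≤ -γ ⟪u k, d⟫` with `0 < γ < 2`, then the
increments tend to zero. -/
lemma tendsto_increment_of_norm_sq_le {E : Type*} [NormedAddCommGroup E] [InnerProductSpace ℝ E]
    {γ : ℝ} (hγ0 : 0 < γ) (hγ2 : γ < 2) {u : ℕ → E}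
    (h : ∀ k, ‖u (k + 1) - u k‖ ^ 2 ≤ -(γ * ⟪u k, u (k + 1) - u k⟫)) :
    Tendsto (fun k => u (k + 1) - u k) atTop (nhds 0) := by
  have key : ∀ k, (2 - γ) * ‖u (k + 1) - u k‖ ^ 2 ≤ γ * (‖u k‖ ^ 2 - ‖u (k + 1)‖ ^ 2) := by
    intro k
    have h1 : ‖u (k + 1)‖ ^ 2 =
        ‖u k‖ ^ 2 + 2 * ⟪u k, u (k + 1) - u k⟫ + ‖u (k + 1) - u k‖ ^ 2 := by
      rw [← norm_add_sq_real, add_sub_cancel]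
    rw [h1]
    linarith [h k]
  have hanti : Antitone fun k => ‖u k‖ ^ 2 := by
    refine antitone_nat_of_succ_le fun k => ?_
    have h0 : 0 ≤ (2 - γ) * ‖u (k + 1) - u k‖ ^ 2 := mul_nonneg (by linarith) (sq_nonneg _)
    exact sub_nonneg.1 (nonneg_of_mul_nonneg_right (h0.trans (key k)) hγ0)
  have hlim := tendsto_atTop_ciInf hanti ⟨0, by rintro _ ⟨k, rfl⟩; positivity⟩
  have hdiff := (hlim.sub ((tendsto_add_atTop_iff_nat 1).2 hlim)).const_mul (γ / (2 - γ))
  rw [sub_self, mul_zero] at hdiff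
  have hsq : Tendsto (fun k => ‖u (k + 1) - u k‖ ^ 2) atTop (nhds 0) := by
    refine squeeze_zero (fun k => sq_nonneg _) (fun k => ?_) hdiff
    rw [div_mul_eq_mul_div, le_div_iff₀ (by linarith), mul_comm]
    exact key k
  rw [tendsto_zero_iff_norm_tendsto_zero]
  simpa [Real.sqrt_sq] using hsq.sqrt

/-- If the one-step increments of a sequence tend to zero, so do its `t`-step increments. -/
lemma tendsto_add_sub_of_tendsto_increment {E : Type*} [SeminormedAddCommGroup E] {u : ℕ → E}
    (h : Tendsto (fun k => u (k + 1) - u k) atTop (nhds 0)) (t : ℕ) :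
    Tendsto (fun k => u (k + t) - u k) atTop (nhds 0) := by
  induction t with
  | zero => simp [tendsto_const_nhds]
  | succ t ih => simpa [← add_assoc] using (h.comp (tendsto_add_atTop_nat t)).add ih

/-- **Projection algorithm, noise-free case: vanishing increments.**
For the linear regression model `y k = ⟪φ (k-1), θ*⟫` (noise free) and estimates
produced by the projection algorithm with gain `0 < γ < 2`, the increments of the
estimates vanish asymptotically: for every fixed `t : ℕ`,
`lim_{k→∞} ‖θ k − θ (k − t)‖ = 0`. -/
theorem projection_algorithm_increments_vanish
    (N : ℕ) (θstar : EuclideanSpace ℝ (Fin N)) (φ : ℕ → EuclideanSpace ℝ (Fin N))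
    (y : ℕ → ℝ) (θ : ℕ → EuclideanSpace ℝ (Fin N)) (γ : ℝ)
    (hγ0 : 0 < γ) (hγ2 : γ < 2)
    (hmodel : ∀ k : ℕ, y (k + 1) = ⟪φ k, θstar⟫)
    (hupdate : ∀ k : ℕ,
      θ (k + 1) = θ k + (γ / (1 + ⟪φ k, φ k⟫)) • ((y (k + 1) - ⟪φ k, θ k⟫) • φ k)) :
    ∀ t : ℕ, Tendsto (fun k : ℕ => ‖θ k - θ (k - t)‖) atTop (nhds 0) := by
  intro t
  have hstep : ∀ k, θ (k + 1) - θ k =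
      (γ / (1 + ⟪φ k, φ k⟫)) • ((-⟪φ k, θ k - θstar⟫) • φ k) := by
    intro k
    rw [hupdate, hmodel, add_sub_cancel_left, inner_sub_right, neg_sub]
  have hinc : Tendsto (fun k => θ (k + 1) - θ k) atTop (nhds 0) := by
    have := tendsto_increment_of_norm_sq_le hγ0 hγ2 (u := fun k => θ k - θstar) fun k => by
      rw [sub_sub_sub_cancel_right, hstep]
      exact norm_sq_projection_step_le hγ0.le _ _
    simpa only [sub_sub_sub_cancel_right] using this
  rw [← tendsto_add_atTop_iff_nat t]
  simpa using (tendsto_add_sub_of_tendsto_increment hinc t).norm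
end

section
/- For the noise-free linear regression model y_k = φ_{k−1}ᵀθ* with estimates produced by the projection algorithm, the normalized prediction errors are square-summable: Σ_{k=1}^{∞} (y_k − φ_{k−1}ᵀθ_{k−1})² / (1 + φ_{k−1}ᵀφ_{k−1}) < ∞. -/
open scoped RealInnerProductSpace

/-- A nonnegative sequence dominated, up to a positive factor, by the decrements of a
nonnegative sequence is summable. -/
theorem summable_of_mul_le_sub_succ {V f : ℕ → ℝ} {c : ℝ} (hc : 0 < c) (hV : ∀ k, 0 ≤ V k)
    (hf : ∀ k, 0 ≤ f k) (h : ∀ k, c * f k ≤ V k - V (k + 1)) : Summable f := by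
  refine summable_of_sum_range_le (c := V 0 / c) hf fun n => ?_
  rw [le_div_iff₀' hc, Finset.mul_sum]
  calc ∑ k ∈ Finset.range n, c * f k
      ≤ ∑ k ∈ Finset.range n, (V k - V (k + 1)) := Finset.sum_le_sum fun k _ => h k
    _ = V 0 - V n := Finset.sum_range_sub' V n
    _ ≤ V 0 := sub_le_self _ (hV n)

/-- One step of the normalized projection update decreases the squared norm of the parameter
error `v` by at least `γ (2 - γ)` times the squared normalized prediction error. -/
theorem projection_step_decrease {E : Type*} [NormedAddCommGroup E] [InnerProductSpace ℝ E]
    (v x : E) (γ : ℝ) :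
    γ * (2 - γ) * (⟪x, v⟫ ^ 2 / (1 + ⟪x, x⟫)) ≤
      ‖v‖ ^ 2 - ‖v - (γ / (1 + ⟪x, x⟫)) • (⟪x, v⟫ • x)‖ ^ 2 := by
  have hs : 0 ≤ ⟪x, x⟫ := real_inner_self_nonneg
  have hm : 0 < 1 + ⟪x, x⟫ := by linarith
  rw [norm_sub_sq_real, smul_smul, norm_smul, mul_pow, ← real_inner_self_eq_norm_sq x,
    Real.norm_eq_abs, sq_abs, inner_smul_right, real_inner_comm x v]
  generalize ⟪x, x⟫ = s at *
  generalize ⟪x, v⟫ = e at *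
  rw [← sub_nonneg]
  have key : ‖v‖ ^ 2 - (‖v‖ ^ 2 - 2 * (γ / (1 + s) * e * e) + (γ / (1 + s) * e) ^ 2 * s)
      - γ * (2 - γ) * (e ^ 2 / (1 + s)) = (γ * e / (1 + s)) ^ 2 := by
    field_simp
    ring
  rw [key]
  positivity

/-- **Projection algorithm, noise-free case: square-summable normalized prediction errors.**
For the linear regression model `y k = ⟪φ (k-1), θ*⟫` (noise free) and estimates
produced by the projection algorithm with gain `0 < γ < 2`, the normalized prediction
errors are square-summable:
`Σ_{k=1}^{∞} (y k − ⟪φ (k-1), θ (k-1)⟫)² / (1 + ⟪φ (k-1), φ (k-1)⟫) < ∞`. -/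
theorem projection_algorithm_errors_square_summable
    (N : ℕ) (θstar : EuclideanSpace ℝ (Fin N)) (φ : ℕ → EuclideanSpace ℝ (Fin N))
    (y : ℕ → ℝ) (θ : ℕ → EuclideanSpace ℝ (Fin N)) (γ : ℝ)
    (hγ0 : 0 < γ) (hγ2 : γ < 2)
    (hmodel : ∀ k : ℕ, y (k + 1) = ⟪φ k, θstar⟫)
    (hupdate : ∀ k : ℕ,
      θ (k + 1) = θ k + (γ / (1 + ⟪φ k, φ k⟫)) • ((y (k + 1) - ⟪φ k, θ k⟫) • φ k)) :
    Summable (fun k : ℕ => (y (k + 1) - ⟪φ k, θ k⟫) ^ 2 / (1 + ⟪φ k, φ k⟫)) := by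
  have herr (k : ℕ) : y (k + 1) - ⟪φ k, θ k⟫ = ⟪φ k, θstar - θ k⟫ := by
    rw [hmodel, inner_sub_right]
  refine summable_of_mul_le_sub_succ (V := fun k => ‖θstar - θ k‖ ^ 2)
    (mul_pos hγ0 (sub_pos.2 hγ2)) (fun k => by positivity) (fun k => ?_) fun k => ?_
  · have : 0 ≤ ⟪φ k, φ k⟫ := real_inner_self_nonneg
    positivity
  · simp only [hupdate k, herr, ← sub_sub]
    exact projection_step_decrease _ _ γ
end

section
/- Consider the parameter-error dynamics θ̃̇(t) = −γ φ(t) φ(t)ᵀ θ̃(t) with γ > 0, arising from the gradient adaptive law for the algebraic error model e_y = θ̃ᵀφ. If φ : [0,∞) → ℝ^N is piecewise continuous, bounded by ‖φ(t)‖ ≤ β for all t, and persistently exciting, then the origin is uniformly exponentially stable: there exist constants C ≥ 1 and λ > 0 (depending only on γ, β, and the PE constants T, α) such that ‖θ̃(t)‖ ≤ C e^{−λ(t−t₀)} ‖θ̃(t₀)‖ for all t ≥ t₀ ≥ 0 and every solution θ̃. -/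
open scoped RealInnerProductSpace
open Set

/-- A function `φ : ℝ → ℝ^N` is persistently exciting with constants `T, α > 0` if
`∫_t^{t+T} φ φᵀ ⪰ α I` for all `t ≥ 0`; equivalently, in quadratic form,
`∫_t^{t+T} ⟪φ(τ), v⟫² dτ ≥ α ‖v‖²` for every direction `v`. -/
def PersistentlyExcitingCT {N : ℕ} (φ : ℝ → EuclideanSpace ℝ (Fin N)) (T α : ℝ) : Prop :=
  ∀ t : ℝ, 0 ≤ t → ∀ v : EuclideanSpace ℝ (Fin N),
    α * ‖v‖ ^ 2 ≤ ∫ τ in t..(t + T), (⟪φ τ, v⟫ : ℝ) ^ 2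

/-- Along solutions of the gradient dynamics, `‖θ‖²` has derivative `-2γ⟪φ, θ⟫²`. -/
theorem hasDerivAt_norm_sq_of_gradient_dynamics {E : Type*} [NormedAddCommGroup E]
    [InnerProductSpace ℝ E] {γ t : ℝ} {φ θ : ℝ → E}
    (h : HasDerivAt θ ((-γ * ⟪φ t, θ t⟫) • φ t) t) :
    HasDerivAt (fun s => ‖θ s‖ ^ 2) (-2 * γ * ⟪φ t, θ t⟫ ^ 2) t := by
  convert h.norm_sq using 1
  rw [real_inner_smul_right, real_inner_comm]
  ring

/-- The norm of a solution of the gradient dynamics is nonincreasing. -/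
theorem antitoneOn_norm_sq_of_gradient_dynamics {E : Type*} [NormedAddCommGroup E]
    [InnerProductSpace ℝ E] {γ : ℝ} (hγ : 0 ≤ γ) {φ θ : ℝ → E}
    (h : ∀ t ∈ Ici (0 : ℝ), HasDerivAt θ ((-γ * ⟪φ t, θ t⟫) • φ t) t) :
    AntitoneOn (fun s => ‖θ s‖ ^ 2) (Ici 0) := by
  have hV := fun t ht => hasDerivAt_norm_sq_of_gradient_dynamics (h t ht)
  refine antitoneOn_of_hasDerivWithinAt_nonpos (convex_Ici 0)
    (fun t ht => (hV t ht).continuousAt.continuousWithinAt)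
    (fun t ht => (hV t (interior_subset ht)).hasDerivWithinAt) fun t _ => ?_
  nlinarith [mul_nonneg hγ (sq_nonneg (⟪φ t, θ t⟫ : ℝ))]

/-- The displacement of a solution over a time at most `T` is controlled by the decrease of
its squared norm. -/
theorem norm_sub_sq_le_of_gradient_dynamics {E : Type*} [NormedAddCommGroup E]
    [InnerProductSpace ℝ E] {γ β T : ℝ} (hT : 0 < T) {φ θ : ℝ → E}
    (hφ : ∀ t, ‖φ t‖ ≤ β)
    (h : ∀ t ∈ Ici (0 : ℝ), HasDerivAt θ ((-γ * ⟪φ t, θ t⟫) • φ t) t)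
    {t τ : ℝ} (ht : 0 ≤ t) (htτ : t ≤ τ) (hτ : τ ≤ t + T) :
    ‖θ τ - θ t‖ ^ 2 ≤ T * γ * β ^ 2 / 2 * (‖θ t‖ ^ 2 - ‖θ τ‖ ^ 2) := by
  set w := θ τ - θ t with hw
  have hG : ∀ s ∈ Icc t τ, HasDerivAt
      (fun s => ⟪θ s, w⟫ - ‖w‖ ^ 2 / (2 * T) * s + T * γ * β ^ 2 / 4 * ‖θ s‖ ^ 2)
      (-γ * ⟪φ s, θ s⟫ * ⟪φ s, w⟫ - ‖w‖ ^ 2 / (2 * T)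
        + T * γ * β ^ 2 / 4 * (-2 * γ * ⟪φ s, θ s⟫ ^ 2)) s := by
    intro s hs
    have hs0 : s ∈ Ici (0 : ℝ) := ht.trans hs.1
    have h1 := (h s hs0).inner ℝ (hasDerivAt_const s w)
    rw [inner_zero_right, zero_add, real_inner_smul_left] at h1
    have h2 := (hasDerivAt_id s).const_mul (‖w‖ ^ 2 / (2 * T))
    rw [mul_one] at h2
    exact (h1.sub h2).add
      ((hasDerivAt_norm_sq_of_gradient_dynamics (h s hs0)).const_mul _)
  have hanti := antitoneOn_of_hasDerivWithinAt_nonpos (convex_Icc t τ)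
    (fun s hs => (hG s hs).continuousAt.continuousWithinAt)
    (fun s hs => (hG s (interior_subset hs)).hasDerivWithinAt) (fun s _ => by
      set a : ℝ := ⟪φ s, θ s⟫
      set b : ℝ := ⟪φ s, w⟫
      have hb : b ^ 2 ≤ β ^ 2 * ‖w‖ ^ 2 := by
        rw [← mul_pow, ← sq_abs]
        exact pow_le_pow_left₀ (abs_nonneg _) ((abs_real_inner_le_norm _ _).trans
          (mul_le_mul_of_nonneg_right (hφ s) (norm_nonneg _))) 2
      have key : -(2 * T) * γ * a * b ≤ ‖w‖ ^ 2 + T ^ 2 * γ ^ 2 * β ^ 2 * a ^ 2 := by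
        by_cases hβ : β = 0
        · have hb0 : b = 0 := by
            rw [hβ] at hb
            nlinarith [sq_nonneg b]
          rw [hb0, mul_zero]
          positivity
        · have hβ2 : 0 < β ^ 2 := by positivity
          nlinarith [sq_nonneg (b + T * γ * β ^ 2 * a)]
      have hrw : -γ * a * b - ‖w‖ ^ 2 / (2 * T) + T * γ * β ^ 2 / 4 * (-2 * γ * a ^ 2)
          = (-(2 * T) * γ * a * b - (‖w‖ ^ 2 + T ^ 2 * γ ^ 2 * β ^ 2 * a ^ 2)) / (2 * T) := by
        field_simp
        ring
      rw [hrw]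
      exact div_nonpos_of_nonpos_of_nonneg (by linarith) (by positivity))
  have hle := hanti (left_mem_Icc.2 htτ) (right_mem_Icc.2 htτ) htτ
  have hinner : (⟪θ τ, w⟫ : ℝ) - ⟪θ t, w⟫ = ‖w‖ ^ 2 := by
    rw [← inner_sub_left, ← hw, real_inner_self_eq_norm_sq]
  have htime : ‖w‖ ^ 2 / (2 * T) * (τ - t) ≤ ‖w‖ ^ 2 / 2 := by
    calc ‖w‖ ^ 2 / (2 * T) * (τ - t) ≤ ‖w‖ ^ 2 / (2 * T) * T := by
          gcongr
          linarith
      _ = ‖w‖ ^ 2 / 2 := by field_simp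
  simp only at hle
  linarith

/-- Over one excitation period the squared norm of a solution contracts by a fixed factor. -/
theorem norm_sq_contraction_of_persistentlyExciting {N : ℕ} {γ β T α : ℝ} (hγ : 0 < γ)
    (hT : 0 < T) {φ θ : ℝ → EuclideanSpace ℝ (Fin N)} (hmeas : Measurable φ)
    (hφ : ∀ t, ‖φ t‖ ≤ β) (hPE : PersistentlyExcitingCT φ T α)
    (h : ∀ t ∈ Ici (0 : ℝ), HasDerivAt θ ((-γ * ⟪φ t, θ t⟫) • φ t) t)
    {t : ℝ} (ht : 0 ≤ t) :
    α * ‖θ t‖ ^ 2 ≤ (1 / γ + T ^ 2 * γ * β ^ 4) * (‖θ t‖ ^ 2 - ‖θ (t + T)‖ ^ 2) := by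
  set D := T * γ * β ^ 2 / 2 * (‖θ t‖ ^ 2 - ‖θ (t + T)‖ ^ 2) with hD
  have hF : ∀ s ∈ Icc t (t + T), HasDerivAt
      (fun s => -(1 / γ) * ‖θ s‖ ^ 2 + 2 * β ^ 2 * D * s)
      (2 * ⟪φ s, θ s⟫ ^ 2 + 2 * β ^ 2 * D) s := by
    intro s hs
    have h1 := (hasDerivAt_norm_sq_of_gradient_dynamics
      (h s (ht.trans hs.1))).const_mul (-(1 / γ))
    have h2 := (hasDerivAt_id s).const_mul (2 * β ^ 2 * D)
    refine (h1.add h2).congr_deriv ?_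
    field_simp
  have hbound : ∀ s, (⟪φ s, θ t⟫ : ℝ) ^ 2 ≤ (β * ‖θ t‖) ^ 2 := fun s => by
    rw [← sq_abs]
    exact pow_le_pow_left₀ (abs_nonneg _) ((abs_real_inner_le_norm _ _).trans
      (mul_le_mul_of_nonneg_right (hφ s) (norm_nonneg _))) 2
  have hint : MeasureTheory.IntegrableOn (fun s => (⟪φ s, θ t⟫ : ℝ) ^ 2) (Icc t (t + T)) := by
    refine MeasureTheory.Measure.integrableOn_of_bounded (M := (β * ‖θ t‖) ^ 2)
      measure_Icc_lt_top.ne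
      ((hmeas.inner measurable_const).pow_const 2).aestronglyMeasurable
      (Filter.Eventually.of_forall fun s => ?_)
    rw [Real.norm_of_nonneg (sq_nonneg _)]
    exact hbound s
  have hle := intervalIntegral.integral_le_sub_of_hasDeriv_right_of_le
    (le_add_of_nonneg_right hT.le)
    (fun s hs => (hF s hs).continuousAt.continuousWithinAt)
    (fun s hs => (hF s (Ioo_subset_Icc_self hs)).hasDerivWithinAt) hint (fun s hs => by
      have hs0 : 0 ≤ s := ht.trans hs.1.le
      have hdisp : ‖θ s - θ t‖ ^ 2 ≤ D :=
        (norm_sub_sq_le_of_gradient_dynamics hT hφ h ht hs.1.le hs.2.le).trans <| by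
          rw [hD]
          exact mul_le_mul_of_nonneg_left (sub_le_sub_left
            (antitoneOn_norm_sq_of_gradient_dynamics hγ.le h hs0
              (hs0.trans hs.2.le) hs.2.le) _) (by positivity)
      have hb : (⟪φ s, θ s - θ t⟫ : ℝ) ^ 2 ≤ β ^ 2 * D := by
        refine le_trans ?_ (mul_le_mul_of_nonneg_left hdisp (sq_nonneg β))
        rw [← mul_pow, ← sq_abs]
        exact pow_le_pow_left₀ (abs_nonneg _) ((abs_real_inner_le_norm _ _).trans
          (mul_le_mul_of_nonneg_right (hφ s) (norm_nonneg _))) 2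
      rw [inner_sub_right] at hb
      nlinarith [sq_nonneg (2 * (⟪φ s, θ s⟫ : ℝ) - ⟪φ s, θ t⟫)])
  have hPEt := (hPE t ht (θ t)).trans hle
  refine hPEt.trans (le_of_eq ?_)
  rw [hD]
  ring

/-- A nonincreasing function contracting by `exp (-(μ T))` over each period `T` decays
exponentially at rate `μ`. -/
theorem le_exp_mul_of_period_contraction {V : ℝ → ℝ} {T μ : ℝ} (hT : 0 < T)
    (hμ : 0 ≤ μ) (hV0 : ∀ t, 0 ≤ V t) (hanti : AntitoneOn V (Ici 0))
    (hc : ∀ t, 0 ≤ t → V (t + T) ≤ Real.exp (-(μ * T)) * V t)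
    {t₀ t : ℝ} (ht₀ : 0 ≤ t₀) (ht : t₀ ≤ t) :
    V t ≤ Real.exp (μ * T) * Real.exp (-μ * (t - t₀)) * V t₀ := by
  have hiter : ∀ n : ℕ, V (t₀ + n * T) ≤ Real.exp (-(μ * (n * T))) * V t₀ := by
    intro n
    induction n with
    | zero => simp
    | succ n ih =>
      have hn : 0 ≤ t₀ + n * T := by positivity
      calc V (t₀ + (n + 1 : ℕ) * T) = V (t₀ + n * T + T) := by push_cast; ring_nf
        _ ≤ Real.exp (-(μ * T)) * (Real.exp (-(μ * (n * T))) * V t₀) :=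
          (hc _ hn).trans (mul_le_mul_of_nonneg_left ih (Real.exp_pos _).le)
        _ = Real.exp (-(μ * ((n + 1 : ℕ) * T))) * V t₀ := by
          rw [← mul_assoc, ← Real.exp_add]; push_cast; ring_nf
  set n := ⌊(t - t₀) / T⌋₊
  have hn1 : n * T ≤ t - t₀ :=
    (le_div_iff₀ hT).1 (Nat.floor_le (div_nonneg (sub_nonneg.2 ht) hT.le))
  have hn2 : t - t₀ < (n + 1) * T := (div_lt_iff₀ hT).1 (Nat.lt_floor_add_one _)
  have hn : 0 ≤ t₀ + n * T := by positivity
  refine (hanti hn (ht₀.trans ht) (by linarith)).trans ((hiter n).trans ?_)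
  rw [← Real.exp_add]
  refine mul_le_mul_of_nonneg_right (Real.exp_le_exp.2 ?_) (hV0 _)
  nlinarith [mul_le_mul_of_nonneg_left hn2.le hμ]

/-- **Uniform exponential stability of the gradient parameter-error dynamics under
persistent excitation.** For the dynamics `θ̃̇ = −γ φ φᵀ θ̃` (i.e. `θ̃̇ = −γ ⟪φ, θ̃⟫ φ`)
with `γ > 0`, if `φ` is piecewise continuous, bounded by `β`, and persistently exciting
with constants `T, α`, then there exist `C ≥ 1` and `λ > 0`, depending only on
`γ, β, T, α`, such that every solution satisfies
`‖θ̃(t)‖ ≤ C e^{−λ(t−t₀)} ‖θ̃(t₀)‖` for all `t ≥ t₀ ≥ 0`. -/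
theorem gradient_error_dynamics_PE_uniform_exponential_stability
    (N : ℕ) (γ β T α : ℝ) (hγ : 0 < γ) (hT : 0 < T) (hα : 0 < α) :
    ∃ C : ℝ, 1 ≤ C ∧ ∃ lam : ℝ, 0 < lam ∧
      ∀ φ : ℝ → EuclideanSpace ℝ (Fin N), Measurable φ → (∀ t : ℝ, ‖φ t‖ ≤ β) →
        PersistentlyExcitingCT φ T α →
        ∀ θt : ℝ → EuclideanSpace ℝ (Fin N),
          (∀ t ∈ Ici (0 : ℝ), HasDerivAt θt ((-γ * ⟪φ t, θt t⟫) • φ t) t) →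
          ∀ t0 t : ℝ, 0 ≤ t0 → t0 ≤ t →
            ‖θt t‖ ≤ C * Real.exp (-lam * (t - t0)) * ‖θt t0‖ := by
  set K := 1 / γ + T ^ 2 * γ * β ^ 4 with hK
  have hKpos : 0 < K := by positivity
  set c := α / K with hcdef
  have hc : 0 < c := div_pos hα hKpos
  set lam := Real.log (1 + c) / (2 * T) with hlam
  have hlog : 0 < Real.log (1 + c) := Real.log_pos (by linarith)
  have hlampos : 0 < lam := by positivity
  refine ⟨Real.exp (lam * T), Real.one_le_exp (by positivity), lam, hlampos, ?_⟩
  intro φ hmeas hφ hPE θt h t0 t ht0 ht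
  have hexp : Real.exp (-(2 * lam * T)) = (1 + c)⁻¹ := by
    rw [Real.exp_neg, show 2 * lam * T = Real.log (1 + c) by rw [hlam]; field_simp,
      Real.exp_log (by linarith)]
  have hdecay := le_exp_mul_of_period_contraction (V := fun s => ‖θt s‖ ^ 2) (μ := 2 * lam)
    hT (by positivity) (fun _ => sq_nonneg _)
    (antitoneOn_norm_sq_of_gradient_dynamics hγ.le h) (fun s hs => by
      have hstep := norm_sq_contraction_of_persistentlyExciting hγ hT hmeas hφ hPE h hs
      have hmono := antitoneOn_norm_sq_of_gradient_dynamics hγ.le h hs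
        (add_nonneg hs hT.le) (le_add_of_nonneg_right hT.le)
      simp only at hmono ⊢
      have hstep' : c * ‖θt s‖ ^ 2 ≤ ‖θt s‖ ^ 2 - ‖θt (s + T)‖ ^ 2 := by
        rw [hcdef, div_mul_eq_mul_div, div_le_iff₀ hKpos, mul_comm _ K]
        exact hstep
      rw [hexp, inv_mul_eq_div, le_div_iff₀ (by linarith)]
      nlinarith [mul_le_mul_of_nonneg_left hmono hc.le]) ht0 ht
  refine (sq_le_sq₀ (norm_nonneg _) (by positivity)).1 ?_
  refine hdecay.trans (le_of_eq ?_)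
  rw [mul_pow, mul_pow, ← Real.exp_nat_mul, ← Real.exp_nat_mul]
  push_cast
  ring_nf
end

section
/- Consider the model reference adaptive control system with state feedback: plant ẋ = A_p x + b_p u with unknown A_p ∈ ℝ^{n×n}, b_p ∈ ℝ^n; reference model ẋ_m = A_m x_m + b_m r with A_m Hurwitz and r bounded piecewise continuous; matching conditions A_p + b_p θ*ᵀ = A_m and b_p k* = b_m with k* ≠ 0; control u = θ(t)ᵀx + k(t)r; adaptive laws θ̇ = −sign(k*) Γ_θ (eᵀP b_m) x and k̇ = −sign(k*) γ_k (eᵀP b_m) r with Γ_θ = Γ_θᵀ ≻ 0, γ_k > 0; tracking error e = x − x_m; and P = Pᵀ ≻ 0 solving A_mᵀP + P A_m = −Q with Q = Qᵀ ≻ 0. Then for every initial condition, the closed-loop signals e(t), θ(t), k(t), x(t), and u(t) are bounded on [0,∞), and the tracking error converges: lim_{t→∞} e(t) = 0. -/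
open scoped RealInnerProductSpace
open Matrix Set Filter

/-- Matrix-vector multiplication as a map on Euclidean space. -/
noncomputable def mvE {n : ℕ} (A : Matrix (Fin n) (Fin n) ℝ) (v : EuclideanSpace ℝ (Fin n)) :
    EuclideanSpace ℝ (Fin n) := Matrix.toEuclideanLin A v

/-- A real square matrix is Hurwitz if all its (complex) eigenvalues have negative real part. -/
def IsHurwitz {n : ℕ} (A : Matrix (Fin n) (Fin n) ℝ) : Prop :=
  ∀ μ ∈ spectrum ℂ (A.map Complex.ofReal), μ.re < 0

section MatrixActions

variable {n : ℕ} (A B : Matrix (Fin n) (Fin n) ℝ) (v w : EuclideanSpace ℝ (Fin n))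

lemma mvE_sub_right : mvE A (v - w) = mvE A v - mvE A w := map_sub _ v w

lemma mvE_smul_right (c : ℝ) : mvE A (c • v) = c • mvE A v := map_smul _ c v

lemma mvE_add_left : mvE (A + B) v = mvE A v + mvE B v := by simp [mvE]

lemma mvE_neg_left : mvE (-A) v = -mvE A v := by simp [mvE]

lemma mvE_mul : mvE (A * B) v = mvE A (mvE B v) := by
  ext i
  simp [mvE, Matrix.toLpLin_apply, Matrix.mulVec_mulVec]

lemma mvE_one : mvE (1 : Matrix (Fin n) (Fin n) ℝ) v = v := by
  ext i
  simp [mvE]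

lemma mvE_vecMulVec (y : EuclideanSpace ℝ (Fin n)) :
    mvE (Matrix.vecMulVec v w) y = ⟪w, y⟫ • v := by
  ext i
  simp [mvE, Matrix.toLpLin_apply, Matrix.vecMulVec_mulVec,
    EuclideanSpace.inner_eq_star_dotProduct, dotProduct_comm]

lemma inner_mvE_transpose : ⟪mvE A v, w⟫ = ⟪v, mvE Aᵀ w⟫ := by
  simp only [mvE, Matrix.toLpLin_apply, EuclideanSpace.inner_eq_star_dotProduct, star_trivial]
  rw [Matrix.mulVec_transpose, Matrix.dotProduct_mulVec]

lemma exists_norm_mvE_le : ∃ C : ℝ, 0 < C ∧ ∀ v, ‖mvE A v‖ ≤ C * ‖v‖ :=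
  (LinearMap.toContinuousLinearMap (Matrix.toEuclideanLin A)).isBoundedLinearMap.bound

variable {A} in
lemma Matrix.PosDef.transpose_eq_self (hA : A.PosDef) : Aᵀ = A := by
  simpa [Matrix.conjTranspose_eq_transpose_of_trivial] using hA.isHermitian.eq

variable {A} in
lemma Matrix.PosDef.inner_mvE_symm (hA : A.PosDef) : ⟪mvE A v, w⟫ = ⟪v, mvE A w⟫ := by
  rw [inner_mvE_transpose, hA.transpose_eq_self]

variable {A} in
lemma Matrix.PosDef.inner_mvE_self_pos (hA : A.PosDef) (hv : v ≠ 0) : 0 < ⟪v, mvE A v⟫ := by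
  have := hA.dotProduct_mulVec_pos (x := v.ofLp) (by simpa using hv)
  simpa [mvE, Matrix.toLpLin_apply, EuclideanSpace.inner_eq_star_dotProduct,
    dotProduct_comm] using this

lemma continuous_mvE : Continuous (mvE A) :=
  (Matrix.toEuclideanLin A).continuous_of_finiteDimensional

variable {A} in
lemma Matrix.PosDef.exists_coercive (hA : A.PosDef) :
    ∃ c : ℝ, 0 < c ∧ ∀ v, c * ‖v‖ ^ 2 ≤ ⟪v, mvE A v⟫ := by
  rcases (Metric.sphere (0 : EuclideanSpace ℝ (Fin n)) 1).eq_empty_or_nonempty with h | h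
  · refine ⟨1, one_pos, fun v => ?_⟩
    obtain rfl : v = 0 := by
      by_contra hv
      have : (‖v‖⁻¹ • v) ∈ Metric.sphere (0 : EuclideanSpace ℝ (Fin n)) 1 := by
        simp [norm_smul, hv]
      simp [h] at this
    simp
  · obtain ⟨y, hy, hmin⟩ := (isCompact_sphere (0 : EuclideanSpace ℝ (Fin n)) 1).exists_isMinOn h
      (f := fun v => ⟪v, mvE A v⟫) (continuous_id.inner (continuous_mvE A)).continuousOn
    have hy0 : y ≠ 0 := by
      rintro rfl
      simp at hy
    refine ⟨_, hA.inner_mvE_self_pos y hy0, fun v => ?_⟩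
    rcases eq_or_ne v 0 with rfl | hv
    · simp
    have hn : 0 < ‖v‖ := norm_pos_iff.2 hv
    have hle := isMinOn_iff.1 hmin (‖v‖⁻¹ • v) (by simp [norm_smul, hv])
    simp only [mvE_smul_right, inner_smul_left, inner_smul_right, conj_trivial] at hle
    calc _ ≤ (‖v‖⁻¹ * (‖v‖⁻¹ * ⟪v, mvE A v⟫)) * ‖v‖ ^ 2 := by gcongr
      _ = ⟪v, mvE A v⟫ := by field_simp

variable {A} in
lemma Matrix.PosDef.hasDerivAt_quadratic (hA : A.PosDef) {f : ℝ → EuclideanSpace ℝ (Fin n)}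
    {f' : EuclideanSpace ℝ (Fin n)} {t : ℝ} (hf : HasDerivAt f f' t) :
    HasDerivAt (fun s => ⟪f s, mvE A (f s)⟫) (2 * ⟪f', mvE A (f t)⟫) t := by
  have hAf : HasDerivAt (fun s => mvE A (f s)) (mvE A f') t :=
    (LinearMap.toContinuousLinearMap (Matrix.toEuclideanLin A)).hasFDerivAt.comp_hasDerivAt t hf
  refine (hf.inner ℝ hAf).congr_deriv ?_
  rw [← hA.inner_mvE_symm, real_inner_comm, two_mul]

/-- Quadratic form of the Lyapunov equation `Aᵀ P + P A = -Q`. -/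
lemma two_mul_inner_mvE_of_lyapunov {P Q : Matrix (Fin n) (Fin n) ℝ} (hP : P.PosDef)
    (h : Aᵀ * P + P * A = -Q) : 2 * ⟪mvE A v, mvE P v⟫ = -⟪v, mvE Q v⟫ := by
  have h₁ : ⟪mvE A v, mvE P v⟫ = ⟪v, mvE (Aᵀ * P) v⟫ := by rw [inner_mvE_transpose, mvE_mul]
  have h₂ : ⟪mvE A v, mvE P v⟫ = ⟪v, mvE (P * A) v⟫ := by
    rw [mvE_mul, ← hP.inner_mvE_symm, real_inner_comm]
  rw [two_mul]
  nth_rewrite 1 [h₁]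
  rw [h₂, ← inner_add_right, ← mvE_add_left, h, mvE_neg_left, inner_neg_right]

end MatrixActions

section ScalarComparison

lemma antitoneOn_Ici_of_hasDerivAt_nonpos {V V' : ℝ → ℝ} {a : ℝ} (hV : ∀ t, HasDerivAt V (V' t) t)
    (hV' : ∀ t, a ≤ t → V' t ≤ 0) : AntitoneOn V (Ici a) := by
  refine antitoneOn_of_deriv_nonpos (convex_Ici a)
    (fun t _ => (hV t).continuousAt.continuousWithinAt)
    (fun t _ => (hV t).differentiableAt.differentiableWithinAt) fun t ht => ?_
  rw [interior_Ici] at ht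
  rw [(hV t).deriv]
  exact hV' t (le_of_lt ht)

lemma le_of_hasDerivAt_le_neg_mul_add {W W' : ℝ → ℝ} {a C : ℝ} (ha : 0 < a)
    (hW : ∀ t, HasDerivAt W (W' t) t) (hW' : ∀ t, 0 ≤ t → W' t ≤ -a * W t + C) {t : ℝ}
    (ht : 0 ≤ t) : W t ≤ C / a + |W 0 - C / a| := by
  have hexp : ∀ s, HasDerivAt (fun s => Real.exp (a * s)) (Real.exp (a * s) * a) s := fun s => by
    simpa using ((hasDerivAt_id s).const_mul a).exp
  have hanti := antitoneOn_Ici_of_hasDerivAt_nonpos (a := 0)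
    (fun s => ((hW s).sub_const (C / a)).mul (hexp s)) fun s hs => by
      have : W' s * Real.exp (a * s) + (W s - C / a) * (Real.exp (a * s) * a)
          = (W' s - (-a * W s + C)) * Real.exp (a * s) := by field_simp; ring
      rw [this]
      exact mul_nonpos_of_nonpos_of_nonneg (sub_nonpos.2 (hW' s hs)) (Real.exp_pos _).le
  have h := hanti (mem_Ici.2 le_rfl) (mem_Ici.2 ht) ht
  simp only [Pi.mul_apply, mul_zero, Real.exp_zero, mul_one] at h
  have h1 : 1 ≤ Real.exp (a * t) := Real.one_le_exp (by positivity)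
  by_contra! hlt
  have h0 := abs_nonneg (W 0 - C / a)
  have := le_abs_self (W 0 - C / a)
  nlinarith

/-- A Lipschitz signal whose squared norm is dissipated by a nonnegative storage function
tends to zero. -/
lemma tendsto_zero_of_dissipation {E : Type*} [NormedAddCommGroup E] [NormedSpace ℝ E]
    {e e' : ℝ → E} {V V' : ℝ → ℝ} {L q : ℝ} (hq : 0 < q)
    (he : ∀ t, HasDerivAt e (e' t) t) (he' : ∀ t, 0 ≤ t → ‖e' t‖ ≤ L)
    (hV : ∀ t, HasDerivAt V (V' t) t) (hV' : ∀ t, 0 ≤ t → V' t ≤ -q * ‖e t‖ ^ 2)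
    (hV0 : ∀ t, 0 ≤ V t) : Tendsto e atTop (nhds 0) := by
  have hanti : AntitoneOn V (Ici 0) := antitoneOn_Ici_of_hasDerivAt_nonpos hV fun t ht =>
    (hV' t ht).trans (by nlinarith [sq_nonneg ‖e t‖])
  have hL : 0 ≤ L := (norm_nonneg _).trans (he' 0 le_rfl)
  have hLip : ∀ s t, 0 ≤ s → s ≤ t → ‖e t - e s‖ ≤ L * (t - s) := fun s t hs hst => by
    have := (convex_Icc s t).norm_image_sub_le_of_norm_hasDerivWithin_le
      (fun τ _ => (he τ).hasDerivWithinAt) (fun τ hτ => he' τ (hs.trans hτ.1))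
      (left_mem_Icc.2 hst) (right_mem_Icc.2 hst)
    rwa [Real.norm_of_nonneg (sub_nonneg.2 hst)] at this
  have hconv : ∃ l, Tendsto V atTop (nhds l) := by
    have hmono : Antitone fun t => V (max t 0) := fun s t hst =>
      hanti (le_max_right s 0) (le_max_right t 0) (max_le_max_right 0 hst)
    refine ⟨_, (tendsto_atTop_ciInf hmono ⟨0, ?_⟩).congr' ?_⟩
    · rintro _ ⟨t, rfl⟩
      exact hV0 _
    · filter_upwards [eventually_ge_atTop 0] with t ht
      rw [max_eq_left ht]
  obtain ⟨l, hl⟩ := hconv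
  rw [Metric.tendsto_atTop']
  intro ε hε
  set δ := ε / (2 * (L + 1)) with hδ
  have hδ0 : 0 < δ := by positivity
  have hLδ : L * δ ≤ ε / 2 := by
    have : (L + 1) * δ = ε / 2 := by rw [hδ]; field_simp
    nlinarith
  have hdiff : Tendsto (fun t => V t - V (t + δ)) atTop (nhds 0) := by
    simpa using hl.sub (hl.comp (tendsto_atTop_add_const_right atTop δ tendsto_id))
  obtain ⟨N, hN⟩ := eventually_atTop.1
    (hdiff.eventually_lt_const (show 0 < q * (ε / 2) ^ 2 * δ by positivity))
  refine ⟨max N 0, fun t ht => ?_⟩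
  have ht0 : 0 ≤ t := (le_max_right N 0).trans ht.le
  rw [dist_zero_right]
  by_contra! hge
  have hlow : ∀ s ∈ Icc t (t + δ), ε / 2 ≤ ‖e s‖ := fun s hs => by
    have h₁ := hLip t s ht0 hs.1
    have h₂ := norm_sub_norm_le (e t) (e s)
    rw [norm_sub_rev] at h₂
    have : L * (s - t) ≤ L * δ := by gcongr; linarith [hs.2]
    linarith
  have hdrop := (convex_Icc t (t + δ)).image_sub_le_mul_sub_of_deriv_le
    (f := V) (C := -q * (ε / 2) ^ 2) (fun s _ => (hV s).continuousAt.continuousWithinAt)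
    (fun s _ => (hV s).differentiableAt.differentiableWithinAt)
    (fun s hs => by
      have hs := interior_subset hs
      rw [(hV s).deriv]
      have : (ε / 2) ^ 2 ≤ ‖e s‖ ^ 2 := by gcongr; exact hlow s hs
      have := hV' s (ht0.trans hs.1)
      nlinarith)
    t (left_mem_Icc.2 (by linarith)) (t + δ) (right_mem_Icc.2 (by linarith)) (by linarith)
  have := hN t ((le_max_left N 0).trans ht.le)
  nlinarith

end ScalarComparison

/-- **MRAC with state feedback: boundedness and asymptotic tracking.**
For the plant `ẋ = Aₚx + bₚu`, reference model `ẋₘ = Aₘxₘ + bₘr` (`Aₘ` Hurwitz, `r`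
bounded), matching conditions `Aₚ + bₚθ*ᵀ = Aₘ`, `bₚk* = bₘ` (`k* ≠ 0`), control
`u = θᵀx + k r`, adaptive laws `θ̇ = −sign(k*) Γ_θ (eᵀPbₘ) x`,
`k̇ = −sign(k*) γ_k (eᵀPbₘ) r`, with `AₘᵀP + PAₘ = −Q`, `P,Q ≻ 0`: for every initial
condition the closed-loop signals `e, θ, k, x, u` are bounded on `[0,∞)` and the
tracking error satisfies `e(t) → 0` as `t → ∞`. -/
theorem mrac_state_feedback_boundedness_and_tracking
    (n : ℕ) (Ap Am : Matrix (Fin n) (Fin n) ℝ) (bp bm : EuclideanSpace ℝ (Fin n))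
    (θstar : EuclideanSpace ℝ (Fin n)) (kstar : ℝ) (hkstar : kstar ≠ 0)
    (Γθ : Matrix (Fin n) (Fin n) ℝ) (hΓθ : Γθ.PosDef) (γk : ℝ) (hγk : 0 < γk)
    (P Q : Matrix (Fin n) (Fin n) ℝ) (hP : P.PosDef) (hQ : Q.PosDef)
    (hAm : IsHurwitz Am)
    (hLyap : Amᵀ * P + P * Am = -Q)
    (hmatch1 : Ap + Matrix.vecMulVec bp θstar = Am)
    (hmatch2 : kstar • bp = bm)
    (r : ℝ → ℝ) (hrbdd : ∃ R : ℝ, ∀ t, |r t| ≤ R) (u : ℝ → ℝ)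
    (x xm θ : ℝ → EuclideanSpace ℝ (Fin n)) (k : ℝ → ℝ)
    (hu : ∀ t, u t = ⟪θ t, x t⟫ + k t * r t)
    (hx : ∀ t, HasDerivAt x (mvE Ap (x t) + u t • bp) t)
    (hxm : ∀ t, HasDerivAt xm (mvE Am (xm t) + r t • bm) t)
    (hθ : ∀ t, HasDerivAt θ
      ((-(Real.sign kstar) * ⟪x t - xm t, mvE P bm⟫) • mvE Γθ (x t)) t)
    (hk : ∀ t, HasDerivAt k
      (-(Real.sign kstar) * γk * ⟪x t - xm t, mvE P bm⟫ * r t) t) :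
    (∃ M : ℝ, ∀ t : ℝ, 0 ≤ t →
      ‖x t - xm t‖ ≤ M ∧ ‖θ t‖ ≤ M ∧ |k t| ≤ M ∧ ‖x t‖ ≤ M ∧ |u t| ≤ M) ∧
      Tendsto (fun t => x t - xm t) atTop (nhds 0) := by
  obtain ⟨R, hR⟩ := hrbdd
  have hR0 : 0 ≤ R := (abs_nonneg _).trans (hR 0)
  have hΓinv : Γθ⁻¹.PosDef := hΓθ.inv
  obtain ⟨p, hp, hPp⟩ := hP.exists_coercive
  obtain ⟨q, hq, hQq⟩ := hQ.exists_coercive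
  obtain ⟨g, hg, hΓg⟩ := hΓinv.exists_coercive
  obtain ⟨CP, hCP, hPC⟩ := exists_norm_mvE_le P
  obtain ⟨CA, hCA, hAC⟩ := exists_norm_mvE_le Am
  have habs : 0 < |kstar| := abs_pos.2 hkstar
  have hsign : Real.sign kstar * kstar = |kstar| := by
    rcases hkstar.lt_or_gt with h | h
    · rw [Real.sign_of_neg h, abs_of_neg h]; ring
    · rw [Real.sign_of_pos h, abs_of_pos h]; ring
  -- Error dynamics.
  set e : ℝ → EuclideanSpace ℝ (Fin n) := fun t => x t - xm t with he_def
  set φ : ℝ → EuclideanSpace ℝ (Fin n) := fun t => θ t - θstar with hφ_def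
  set s : ℝ → ℝ := fun t => ⟪φ t, x t⟫ + (k t - kstar) * r t with hs_def
  have he : ∀ t, HasDerivAt e (mvE Am (e t) + s t • bp) t := fun t => by
    refine ((hx t).sub (hxm t)).congr_deriv ?_
    have hApx : mvE Am (x t) = mvE Ap (x t) + ⟪θstar, x t⟫ • bp := by
      rw [← hmatch1, mvE_add_left, mvE_vecMulVec]
    simp only [he_def, hs_def, hφ_def, mvE_sub_right, hApx, hu, ← hmatch2, inner_sub_left]
    module
  have hPbm : ∀ t, ⟪e t, mvE P bm⟫ = kstar * ⟪e t, mvE P bp⟫ := fun t => by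
    rw [← hmatch2, mvE_smul_right, inner_smul_right]
  -- The Lyapunov function of the closed loop.
  set V : ℝ → ℝ := fun t => ⟪e t, mvE P (e t)⟫
    + |kstar|⁻¹ * (⟪φ t, mvE Γθ⁻¹ (φ t)⟫ + γk⁻¹ * (k t - kstar) ^ 2) with hV_def
  have hV : ∀ t, HasDerivAt V (-⟪e t, mvE Q (e t)⟫) t := fun t => by
    have h := (hP.hasDerivAt_quadratic (he t)).add
      (((hΓinv.hasDerivAt_quadratic ((hθ t).sub_const θstar)).add
        ((((hk t).sub_const kstar).pow 2).const_mul γk⁻¹)).const_mul |kstar|⁻¹)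
    refine h.congr_deriv ?_
    have hΓ : ⟪mvE Γθ (x t), mvE Γθ⁻¹ (φ t)⟫ = ⟪φ t, x t⟫ := by
      rw [← hΓinv.inner_mvE_symm, ← mvE_mul,
        Matrix.nonsing_inv_mul _ ((Matrix.isUnit_iff_isUnit_det _).1 hΓθ.isUnit), mvE_one,
        real_inner_comm]
    have hL := two_mul_inner_mvE_of_lyapunov Am (e t) hP hLyap
    have hbp : ⟪bp, mvE P (e t)⟫ = ⟪e t, mvE P bp⟫ := by
      rw [← hP.inner_mvE_symm, real_inner_comm]
    change 2 * ⟪mvE Am (e t) + s t • bp, mvE P (e t)⟫ + |kstar|⁻¹ *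
      (2 * ⟪(-(Real.sign kstar) * ⟪e t, mvE P bm⟫) • mvE Γθ (x t), mvE Γθ⁻¹ (φ t)⟫ +
        γk⁻¹ * (((2 : ℕ) : ℝ) * (k t - kstar) ^ (2 - 1) *
          (-(Real.sign kstar) * γk * ⟪e t, mvE P bm⟫ * r t))) = _
    rw [inner_add_left, real_inner_smul_left, real_inner_smul_left, hΓ, hbp, mul_add, hL, hPbm]
    have hγ : γk⁻¹ * γk = 1 := inv_mul_cancel₀ hγk.ne'
    have hab : |kstar|⁻¹ * (Real.sign kstar * kstar) = 1 := by
      rw [hsign, inv_mul_cancel₀ habs.ne']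
    simp only [hs_def]
    push_cast
    linear_combination (-2 * ⟪e t, mvE P bp⟫ * ⟪φ t, x t⟫
        - 2 * ⟪e t, mvE P bp⟫ * (k t - kstar) * r t) * hab
      - 2 * |kstar|⁻¹ * (Real.sign kstar * kstar) * ⟪e t, mvE P bp⟫ * (k t - kstar) * r t * hγ
  have hV' : ∀ t, 0 ≤ t → -⟪e t, mvE Q (e t)⟫ ≤ -q * ‖e t‖ ^ 2 := fun t _ => by
    linarith [hQq (e t)]
  have hVlow : ∀ t, p * ‖e t‖ ^ 2
      + |kstar|⁻¹ * (g * ‖φ t‖ ^ 2 + γk⁻¹ * (k t - kstar) ^ 2) ≤ V t := fun t => by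
    simp only [hV_def]
    gcongr
    · exact hPp _
    · exact hΓg _
  have hV0 : ∀ t, 0 ≤ V t := fun t => le_trans (by positivity) (hVlow t)
  have hVle : ∀ t, 0 ≤ t → V t ≤ V 0 := fun t ht =>
    antitoneOn_Ici_of_hasDerivAt_nonpos hV
      (fun t ht => (hV' t ht).trans (by nlinarith [sq_nonneg ‖e t‖]))
      (mem_Ici.2 le_rfl) (mem_Ici.2 ht) ht
  have hbound : ∀ c y B : ℝ, 0 < c → c * y ^ 2 ≤ B → |y| ≤ √(B / c) := fun c y B hc h =>
    Real.abs_le_sqrt ((le_div_iff₀' hc).2 h)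
  obtain ⟨Me, hMe⟩ : ∃ M, ∀ t, 0 ≤ t → ‖e t‖ ≤ M := ⟨_, fun t ht => by
    have h₁ : 0 ≤ |kstar|⁻¹ * (g * ‖φ t‖ ^ 2 + γk⁻¹ * (k t - kstar) ^ 2) := by positivity
    simpa using hbound p ‖e t‖ (V 0) hp (by linarith [hVlow t, hVle t ht])⟩
  obtain ⟨Mφ, hMφ⟩ : ∃ M, ∀ t, 0 ≤ t → ‖φ t‖ ≤ M := ⟨_, fun t ht => by
    have h₁ : 0 ≤ p * ‖e t‖ ^ 2 := by positivity
    have h₂ : 0 ≤ |kstar|⁻¹ * (γk⁻¹ * (k t - kstar) ^ 2) := by positivity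
    simpa using hbound (|kstar|⁻¹ * g) ‖φ t‖ (V 0) (by positivity)
      (by linarith [hVlow t, hVle t ht])⟩
  obtain ⟨Mκ, hMκ⟩ : ∃ M, ∀ t, 0 ≤ t → |k t - kstar| ≤ M := ⟨_, fun t ht => by
    have h₁ : 0 ≤ p * ‖e t‖ ^ 2 := by positivity
    have h₂ : 0 ≤ |kstar|⁻¹ * (g * ‖φ t‖ ^ 2) := by positivity
    exact hbound (|kstar|⁻¹ * γk⁻¹) (k t - kstar) (V 0) (by positivity)
      (by linarith [hVlow t, hVle t ht])⟩
  -- The reference model is bounded-input bounded-state.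
  obtain ⟨Mm, hMm⟩ : ∃ M, ∀ t, 0 ≤ t → ‖xm t‖ ≤ M := by
    have hW := fun t => hP.hasDerivAt_quadratic (hxm t)
    set β := R * ‖mvE P bm‖ with hβ
    have hWt := fun t ht => le_of_hasDerivAt_le_neg_mul_add (a := q / (2 * CP)) (C := 2 * β ^ 2 / q)
      (by positivity) hW (fun t _ => by
        have hL := two_mul_inner_mvE_of_lyapunov Am (xm t) hP hLyap
        have hup : ⟪xm t, mvE P (xm t)⟫ ≤ CP * ‖xm t‖ ^ 2 := by
          calc _ ≤ ‖xm t‖ * ‖mvE P (xm t)‖ := real_inner_le_norm _ _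
            _ ≤ ‖xm t‖ * (CP * ‖xm t‖) := by gcongr; exact hPC _
            _ = _ := by ring
        have hcross : r t * ⟪bm, mvE P (xm t)⟫ ≤ β * ‖xm t‖ := by
          rw [← hP.inner_mvE_symm]
          calc _ ≤ |r t * ⟪mvE P bm, xm t⟫| := le_abs_self _
            _ = |r t| * |⟪mvE P bm, xm t⟫| := abs_mul _ _
            _ ≤ R * (‖mvE P bm‖ * ‖xm t‖) := by
              gcongr
              · exact hR t
              · exact abs_real_inner_le_norm _ _
            _ = _ := by rw [hβ]; ring
        have hyoung : 2 * (β * ‖xm t‖) ≤ q / 2 * ‖xm t‖ ^ 2 + 2 * β ^ 2 / q := by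
          have : q / 2 * ‖xm t‖ ^ 2 + 2 * β ^ 2 / q - 2 * (β * ‖xm t‖)
              = (q * ‖xm t‖ - 2 * β) ^ 2 / (2 * q) := by field_simp; ring
          have : 0 ≤ (q * ‖xm t‖ - 2 * β) ^ 2 / (2 * q) := by positivity
          linarith
        have hscale : q / (2 * CP) * ⟪xm t, mvE P (xm t)⟫ ≤ q / 2 * ‖xm t‖ ^ 2 := by
          calc _ ≤ q / (2 * CP) * (CP * ‖xm t‖ ^ 2) := by gcongr
            _ = _ := by field_simp
        rw [inner_add_left, real_inner_smul_left, mul_add, hL]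
        linarith [hQq (xm t)]) (t := t) ht
    exact ⟨_, fun t ht => by simpa using hbound p ‖xm t‖ _ hp ((hPp (xm t)).trans (hWt t ht))⟩
  have hMx : ∀ t, 0 ≤ t → ‖x t‖ ≤ Me + Mm := fun t ht => by
    have h : x t = e t + xm t := by simp [he_def]
    rw [h]
    exact (norm_add_le _ _).trans (add_le_add (hMe t ht) (hMm t ht))
  have hMθ : ∀ t, 0 ≤ t → ‖θ t‖ ≤ Mφ + ‖θstar‖ := fun t ht => by
    have h : θ t = φ t + θstar := by simp [hφ_def]
    rw [h]
    exact (norm_add_le _ _).trans (add_le_add_left (hMφ t ht) _)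
  have hMk : ∀ t, 0 ≤ t → |k t| ≤ Mκ + |kstar| := fun t ht => by
    have h := abs_add_le (k t - kstar) kstar
    rw [sub_add_cancel] at h
    linarith [hMκ t ht]
  have haffine : ∀ {v w : EuclideanSpace ℝ (Fin n)} {a b Mv Mw Ma : ℝ}, ‖v‖ ≤ Mv → ‖w‖ ≤ Mw →
      |a| ≤ Ma → |b| ≤ R → |⟪v, w⟫ + a * b| ≤ Mv * Mw + Ma * R := by
    intro v w a b Mv Mw Ma hv hw ha hb
    refine (abs_add_le _ _).trans (add_le_add ?_ ?_)
    · exact (abs_real_inner_le_norm _ _).trans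
        (mul_le_mul hv hw (norm_nonneg _) ((norm_nonneg _).trans hv))
    · rw [abs_mul]
      exact mul_le_mul ha hb (abs_nonneg _) ((abs_nonneg _).trans ha)
  have hMu : ∀ t, 0 ≤ t → |u t| ≤ (Mφ + ‖θstar‖) * (Me + Mm) + (Mκ + |kstar|) * R :=
    fun t ht => hu t ▸ haffine (hMθ t ht) (hMx t ht) (hMk t ht) (hR t)
  refine ⟨⟨max Me (max (Mφ + ‖θstar‖) (max (Mκ + |kstar|) (max (Me + Mm)
    ((Mφ + ‖θstar‖) * (Me + Mm) + (Mκ + |kstar|) * R)))), fun t ht => ?_⟩, ?_⟩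
  · simp only [le_max_iff]
    exact ⟨.inl (hMe t ht), .inr (.inl (hMθ t ht)), .inr (.inr (.inl (hMk t ht))),
      .inr (.inr (.inr (.inl (hMx t ht)))), .inr (.inr (.inr (.inr (hMu t ht))))⟩
  · refine tendsto_zero_of_dissipation
      (L := CA * Me + (Mφ * (Me + Mm) + Mκ * R) * ‖bp‖) hq he (fun t ht => ?_) hV hV' hV0
    refine (norm_add_le _ _).trans (add_le_add ?_ ?_)
    · exact (hAC _).trans (by gcongr; exact hMe t ht)
    · rw [norm_smul, Real.norm_eq_abs]
      gcongr
      exact haffine (hMφ t ht) (hMx t ht) (hMκ t ht) (hR t)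
end

section
/- Consider the speed-gradient adaptive scheme: the closed-loop state x(t) ∈ ℝ^n evolves so that the C¹ goal function Q(x,t) ≥ 0 satisfies (d/dt)Q(x(t),t) = w(x(t), θ(t), t), where w(x,θ,t) is C¹ in θ, and the adjustable parameter evolves by the speed-gradient law θ̇ = −Γ ∇_θ w(x,θ,t) with Γ = Γᵀ ≻ 0. Suppose there exists θ* ∈ ℝ^N such that (i) w(x,θ,t) is convex in θ for every fixed (x,t), and (ii) w(x,θ*,t) ≤ 0 for all (x,t). Then along every solution, the function V(x,θ,t) = Q(x,t) + ½(θ − θ*)ᵀΓ^{−1}(θ − θ*) satisfies V̇(t) ≤ w(x(t), θ*, t) ≤ 0; in particular V is nonincreasing along solutions. -/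
open scoped RealInnerProductSpace
open Matrix Set

/-- A convex function lies above its tangent hyperplanes. -/
theorem ConvexOn.add_inner_gradient_le {E : Type*} [NormedAddCommGroup E]
    [InnerProductSpace ℝ E] [CompleteSpace E] {f : E → ℝ} {g a : E}
    (hf : ConvexOn ℝ Set.univ f) (hg : HasGradientAt f g a) (b : E) :
    f a + ⟪g, b - a⟫ ≤ f b := by
  have hline : ConvexOn ℝ Set.univ (f ∘ (AffineMap.lineMap a b : ℝ →ᵃ[ℝ] E)) :=
    hf.comp_affineMap (AffineMap.lineMap a b)
  have hderiv : HasDerivAt (f ∘ (AffineMap.lineMap a b : ℝ →ᵃ[ℝ] E)) ⟪g, b - a⟫ 0 := by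
    have h : HasFDerivAt f (InnerProductSpace.toDual ℝ E g)
        ((AffineMap.lineMap a b : ℝ →ᵃ[ℝ] E) 0) := by
      simpa using hg.hasFDerivAt
    simpa using h.comp_hasDerivAt (0 : ℝ) AffineMap.hasDerivAt_lineMap
  have h := hline.le_slope_of_hasDerivAt (Set.mem_univ 0) (Set.mem_univ 1) one_pos hderiv
  simp [slope_def_field] at h
  linarith

/-- The derivative of half the quadratic form of a symmetric operator along a curve. -/
theorem LinearMap.IsSymmetric.hasDerivAt_half_inner {E : Type*} [NormedAddCommGroup E]
    [InnerProductSpace ℝ E] [FiniteDimensional ℝ E] {A : E →ₗ[ℝ] E} (hA : A.IsSymmetric)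
    {u : ℝ → E} {v : E} {t : ℝ} (hu : HasDerivAt u v t) :
    HasDerivAt (fun s => (1 / 2) * ⟪u s, A (u s)⟫) ⟪u t, A v⟫ t := by
  have hAu : HasDerivAt (fun s => A (u s)) (A v) t :=
    A.toContinuousLinearMap.hasFDerivAt.comp_hasDerivAt t hu
  refine ((hu.inner ℝ hAu).const_mul (1 / 2)).congr_deriv ?_
  rw [← hA v (u t), real_inner_comm]
  ring

theorem Matrix.PosDef.isSymmetric_toEuclideanLin_inv {N : ℕ} {Γ : Matrix (Fin N) (Fin N) ℝ}
    (hΓ : Γ.PosDef) : (Matrix.toEuclideanLin Γ⁻¹).IsSymmetric :=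
  Matrix.isSymmetric_toEuclideanLin_iff.mpr hΓ.inv.isHermitian

theorem mvE_inv_mvE {N : ℕ} {Γ : Matrix (Fin N) (Fin N) ℝ} (hΓ : Γ.PosDef)
    (v : EuclideanSpace ℝ (Fin N)) : mvE Γ⁻¹ (mvE Γ v) = v := by
  have hdet : IsUnit Γ.det := (Matrix.isUnit_iff_isUnit_det Γ).mp hΓ.isUnit
  simp [mvE, Matrix.toLpLin_apply, Matrix.mulVec_mulVec, Matrix.nonsing_inv_mul Γ hdet]

/-- **Speed-gradient adaptive scheme: Lyapunov decrease.**
The closed-loop state satisfies `(d/dt)Q(x(t),t) = w(x(t),θ(t),t)` with `Q ≥ 0`, and the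
adjustable parameter evolves by the speed-gradient law `θ̇ = −Γ ∇_θ w(x,θ,t)`, `Γ ≻ 0`.
If `w(x,·,t)` is convex for each `(x,t)` and `w(x,θ*,t) ≤ 0` for all `(x,t)`, then along
every solution the function `V = Q(x,t) + ½(θ−θ*)ᵀΓ⁻¹(θ−θ*)` satisfies
`V̇(t) = w(x,θ,t) − (θ−θ*)ᵀ∇_θw ≤ w(x(t),θ*,t) ≤ 0`; in particular `V` is nonincreasing. -/
theorem speed_gradient_lyapunov_decrease
    (n N : ℕ)
    (Q : EuclideanSpace ℝ (Fin n) → ℝ → ℝ)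
    (w : EuclideanSpace ℝ (Fin n) → EuclideanSpace ℝ (Fin N) → ℝ → ℝ)
    (gradw : EuclideanSpace ℝ (Fin n) → EuclideanSpace ℝ (Fin N) → ℝ →
      EuclideanSpace ℝ (Fin N))
    (hQnonneg : ∀ xv t, 0 ≤ Q xv t)
    (hgrad : ∀ xv θv t, HasGradientAt (fun ϑ => w xv ϑ t) (gradw xv θv t) θv)
    (Γ : Matrix (Fin N) (Fin N) ℝ) (hΓ : Γ.PosDef)
    (θstar : EuclideanSpace ℝ (Fin N))
    (hconvex : ∀ xv t, ConvexOn ℝ Set.univ (fun ϑ => w xv ϑ t))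
    (hθstar : ∀ xv t, w xv θstar t ≤ 0)
    (x : ℝ → EuclideanSpace ℝ (Fin n)) (θ : ℝ → EuclideanSpace ℝ (Fin N))
    (hQdot : ∀ t : ℝ, HasDerivAt (fun s => Q (x s) s) (w (x t) (θ t) t) t)
    (hθdot : ∀ t : ℝ, HasDerivAt θ (-(mvE Γ (gradw (x t) (θ t) t))) t) :
    (∀ t : ℝ, HasDerivAt
        (fun s => Q (x s) s + (1 / 2) * ⟪θ s - θstar, mvE Γ⁻¹ (θ s - θstar)⟫)
        (w (x t) (θ t) t - ⟪θ t - θstar, gradw (x t) (θ t) t⟫) t) ∧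
      (∀ t : ℝ,
        w (x t) (θ t) t - ⟪θ t - θstar, gradw (x t) (θ t) t⟫ ≤ w (x t) θstar t) ∧
      (∀ t : ℝ, w (x t) θstar t ≤ 0) ∧
      Antitone (fun t =>
        Q (x t) t + (1 / 2) * ⟪θ t - θstar, mvE Γ⁻¹ (θ t - θstar)⟫) := by
  have hderiv : ∀ t : ℝ, HasDerivAt
      (fun s => Q (x s) s + (1 / 2) * ⟪θ s - θstar, mvE Γ⁻¹ (θ s - θstar)⟫)
      (w (x t) (θ t) t - ⟪θ t - θstar, gradw (x t) (θ t) t⟫) t := by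
    intro t
    have hV := hΓ.isSymmetric_toEuclideanLin_inv.hasDerivAt_half_inner
      ((hθdot t).sub_const θstar)
    refine ((hQdot t).add hV).congr_deriv ?_
    rw [map_neg, inner_neg_right, ← sub_eq_add_neg]
    exact congrArg (fun v => w (x t) (θ t) t - ⟪θ t - θstar, v⟫) (mvE_inv_mvE hΓ _)
  have hle : ∀ t : ℝ,
      w (x t) (θ t) t - ⟪θ t - θstar, gradw (x t) (θ t) t⟫ ≤ w (x t) θstar t := by
    intro t
    have h := (hconvex (x t) t).add_inner_gradient_le (hgrad (x t) (θ t) t) θstar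
    rwa [← neg_sub (θ t) θstar, inner_neg_right, real_inner_comm, ← sub_eq_add_neg] at h
  refine ⟨hderiv, hle, fun t => hθstar (x t) t, ?_⟩
  exact antitone_of_hasDerivAt_nonpos hderiv fun t => (hle t).trans (hθstar (x t) t)
end
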